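/- Let φ be an eigenfunction of 𝕃 = -Δ + 1 - pū_ε^{p-1} with eigenvalue λ bounded away from 1, normalized so ‖φ‖_∞ = 1. Then for every η ∈ (0,1) there exists C, independent of ε, such that |φ(x)| + |∇φ(x)| ≤ C e^{-η d_x} where d_x = dist(x, set of bump centers). -/

import Mathlib

open Real

/-- Unit vector along the first coordinate axis of `ℝ^N`. -/
noncomputable def e1 (N : ℕ) : EuclideanSpace ℝ (Fin N) :=
  if h : 0 < N then EuclideanSpace.single (⟨0, h⟩ : Fin N) (1 : ℝ) else 0

/-- Laplacian of a function on `ℝ^N`. -/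
noncomputable def lap {N : ℕ} (f : EuclideanSpace ℝ (Fin N) → ℝ)
    (x : EuclideanSpace ℝ (Fin N)) : ℝ :=
  ∑ i : Fin N, deriv (deriv (fun t : ℝ => f (x + t • EuclideanSpace.single i (1 : ℝ)))) 0

/-- Second-order necessary condition for a local minimum. -/
theorem deriv_deriv_nonneg_of_isLocalMin {f : ℝ → ℝ} {a : ℝ} (hf : ContinuousAt f a)
    (h : IsLocalMin f a) : 0 ≤ deriv (deriv f) a := by
  by_contra! hneg
  have hmax := isLocalMax_of_deriv_deriv_neg hneg h.deriv_eq_zero hf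
  have hconst : f =ᶠ[nhds a] fun _ => f a := by
    filter_upwards [h, hmax] with y h1 h2 using le_antisymm h2 h1
  have h2 : deriv (deriv f) a = 0 := by
    rw [hconst.deriv.deriv_eq]
    simp
  linarith

section Laplacian

variable {N : ℕ}

local notation "E" => EuclideanSpace ℝ (Fin N)

theorem contDiff_line {f : E → ℝ} (hf : ContDiff ℝ 2 f) (x v : E) :
    ContDiff ℝ 2 fun t : ℝ => f (x + t • v) :=
  hf.comp (by fun_prop)

theorem deriv_deriv_sub {f g : ℝ → ℝ} (hf : ContDiff ℝ 2 f) (hg : ContDiff ℝ 2 g) (a : ℝ) :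
    deriv (deriv fun t => f t - g t) a = deriv (deriv f) a - deriv (deriv g) a := by
  have h1 : deriv (fun t => f t - g t) = fun t => deriv f t - deriv g t := by
    funext t
    exact deriv_fun_sub (hf.differentiable (by norm_num) t) (hg.differentiable (by norm_num) t)
  rw [h1]
  have h (f : ℝ → ℝ) (hf : ContDiff ℝ 2 f) : Differentiable ℝ (deriv f) := by
    have : ContDiff ℝ (1 + 1) f := by rwa [one_add_one_eq_two]
    exact ((contDiff_succ_iff_deriv.mp this).2.2).differentiable (by norm_num)
  exact deriv_fun_sub (h f hf a) (h g hg a)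

theorem lap_sub {f g : E → ℝ} (hf : ContDiff ℝ 2 f) (hg : ContDiff ℝ 2 g) (x : E) :
    lap (fun y => f y - g y) x = lap f x - lap g x := by
  simp only [lap, ← Finset.sum_sub_distrib]
  exact Finset.sum_congr rfl fun i _ =>
    deriv_deriv_sub (contDiff_line hf x _) (contDiff_line hg x _) 0

theorem lap_const_mul (c : ℝ) (f : E → ℝ) (x : E) :
    lap (fun y => c * f y) x = c * lap f x := by
  simp only [lap, Finset.mul_sum, deriv_const_mul_field']

theorem lap_neg (f : E → ℝ) (x : E) : lap (fun y => -f y) x = -lap f x := by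
  simpa using lap_const_mul (-1) f x

theorem lap_comp_add (f : E → ℝ) (a x : E) :
    lap (fun y => f (a + y)) x = lap f (a + x) := by
  simp only [lap, add_assoc]

theorem lap_nonneg_of_isLocalMin {f : E → ℝ} (hf : Continuous f) {x : E}
    (h : IsLocalMin f x) : 0 ≤ lap f x := by
  refine Finset.sum_nonneg fun i _ => deriv_deriv_nonneg_of_isLocalMin ?_ ?_
  · exact (hf.comp (by fun_prop)).continuousAt
  · have hc : Filter.Tendsto (fun t : ℝ => x + t • (EuclideanSpace.single i (1 : ℝ) : E))
        (nhds 0) (nhds x) := by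
      have : Continuous fun t : ℝ => x + t • (EuclideanSpace.single i (1 : ℝ) : E) := by fun_prop
      simpa using this.tendsto 0
    have := hc.eventually h
    simpa [IsLocalMin, IsMinFilter] using this

theorem lap_le_lap_of_isLocalMin_sub {f g : E → ℝ} (hf : ContDiff ℝ 2 f) (hg : ContDiff ℝ 2 g)
    {x : E} (h : IsLocalMin (fun y => f y - g y) x) : lap g x ≤ lap f x := by
  have : 0 ≤ lap (fun y => f y - g y) x :=
    lap_nonneg_of_isLocalMin (hf.continuous.sub hg.continuous) h
  rw [lap_sub hf hg] at this
  linarith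

/-- Weak maximum principle: if `g ≤ f` on the part of a compact set outside an open subset, and
`lap f < lap g` wherever `f < g` in the open subset, then `g ≤ f`. -/
theorem le_of_lap_lt {f g : E → ℝ} (hf : ContDiff ℝ 2 f) (hg : ContDiff ℝ 2 g)
    {Q O : Set E} (hQ : IsCompact Q) (hO : IsOpen O) (hOQ : O ⊆ Q)
    (hb : ∀ x ∈ Q, x ∉ O → g x ≤ f x) (hlap : ∀ x ∈ O, f x < g x → lap f x < lap g x)
    {x : E} (hx : x ∈ Q) : g x ≤ f x := by
  obtain ⟨z, hzQ, hz⟩ := hQ.exists_isMinOn ⟨x, hx⟩ (hf.continuous.sub hg.continuous).continuousOn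
  by_contra! hlt
  have hzx : f z - g z ≤ f x - g x := hz hx
  have hzO : z ∈ O := by
    by_contra h
    linarith [hb z hzQ h]
  have hloc : IsLocalMin (fun y => f y - g y) z :=
    (hz.on_subset hOQ).isLocalMin (hO.mem_nhds hzO)
  linarith [hlap z hzO (by linarith), lap_le_lap_of_isLocalMin_sub hf hg hloc]

/-- Reflection of the `i`-th coordinate. -/
noncomputable def reflectCoord (i : Fin N) (x : E) : E :=
  x - (2 * x i) • EuclideanSpace.single i (1 : ℝ)

theorem reflectCoord_apply (i j : Fin N) (x : E) :
    reflectCoord i x j = if j = i then -x i else x j := by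
  by_cases h : j = i
  · subst h
    simp [reflectCoord]
    ring
  · simp [reflectCoord, h]

theorem contDiff_reflectCoord (i : Fin N) : ContDiff ℝ 2 (reflectCoord i : E → E) := by
  unfold reflectCoord
  fun_prop

theorem lap_comp_reflectCoord (f : E → ℝ) (i : Fin N) (x : E) :
    lap (fun y => f (reflectCoord i y)) x = lap f (reflectCoord i x) := by
  refine Finset.sum_congr rfl fun j _ => ?_
  by_cases h : j = i
  · subst h
    set F : ℝ → ℝ := fun t => f (reflectCoord j x + t • EuclideanSpace.single j (1 : ℝ)) with hF
    have hG : (fun t : ℝ => f (reflectCoord j (x + t • EuclideanSpace.single j (1 : ℝ))))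
        = fun t => F (-t) := by
      funext t
      simp only [hF]
      congr 1
      ext l
      by_cases hl : l = j
      · subst hl
        simp [reflectCoord]
        ring
      · simp [reflectCoord, hl]
    rw [hG]
    have h1 : deriv (fun t => F (-t)) = fun t => -deriv F (-t) := by
      funext t
      exact deriv_comp_neg F t
    rw [h1, deriv.fun_neg, deriv_comp_neg]
    simp
  · have hG : (fun t : ℝ => f (reflectCoord i (x + t • EuclideanSpace.single j (1 : ℝ))))
        = fun t => f (reflectCoord i x + t • EuclideanSpace.single j (1 : ℝ)) := by
      funext t
      congr 1
      have : i ≠ j := fun h' => h h'.symm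
      ext l
      simp [reflectCoord, this]
      ring
    rw [hG]

theorem lap_quadratic (i : Fin N) (a b c : ℝ) (x : E) :
    lap (fun y : E => a * ‖y‖ ^ 2 + b * y i + c * y i ^ 2) x = 2 * N * a + 2 * c := by
  have key : ∀ j : Fin N, deriv (deriv fun t : ℝ =>
      (fun y : E => a * ‖y‖ ^ 2 + b * y i + c * y i ^ 2)
        (x + t • EuclideanSpace.single j (1 : ℝ))) 0 = 2 * a + if j = i then 2 * c else 0 := by
    intro j
    set s : ℝ := if j = i then 1 else 0 with hs
    have h0 : (fun t : ℝ => (fun y : E => a * ‖y‖ ^ 2 + b * y i + c * y i ^ 2)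
        (x + t • EuclideanSpace.single j (1 : ℝ))) =
        fun t => a * (‖x‖ ^ 2 + 2 * x j * t + t ^ 2) + b * (x i + s * t)
          + c * (x i + s * t) ^ 2 := by
      funext t
      have h1 : (x + t • EuclideanSpace.single j (1 : ℝ)) i = x i + s * t := by
        by_cases h : j = i
        · subst h; simp [hs]
        · have : i ≠ j := fun h' => h h'.symm
          simp [hs, h, this]
      have h2 : ‖x + t • EuclideanSpace.single j (1 : ℝ)‖ ^ 2
          = ‖x‖ ^ 2 + 2 * x j * t + t ^ 2 := by
        rw [norm_add_sq_real, inner_smul_right, norm_smul]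
        simp [EuclideanSpace.inner_single_right]
        ring
      simp only [h1, h2]
    rw [h0]
    have h1 : (deriv fun t : ℝ => a * (‖x‖ ^ 2 + 2 * x j * t + t ^ 2) + b * (x i + s * t)
          + c * (x i + s * t) ^ 2) =
        fun t => a * (2 * x j + 2 * t) + b * s + c * (2 * (x i + s * t) * s) := by
      funext t
      have hl : HasDerivAt (fun t : ℝ => x i + s * t) s t := by
        simpa using ((hasDerivAt_id t).const_mul s).const_add (x i)
      have hq : HasDerivAt (fun t : ℝ => ‖x‖ ^ 2 + 2 * x j * t + t ^ 2) (2 * x j + 2 * t) t := by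
        exact ((((hasDerivAt_id t).const_mul (2 * x j)).const_add (‖x‖ ^ 2)).add
          (hasDerivAt_pow 2 t)).congr_deriv (by simp)
      have := ((hq.const_mul a).add (hl.const_mul b)).add ((hl.pow 2).const_mul c)
      exact (this.congr_deriv (by simp)).deriv
    rw [h1]
    have h2 : HasDerivAt (fun t : ℝ => a * (2 * x j + 2 * t) + b * s
        + c * (2 * (x i + s * t) * s)) (2 * a + 2 * c * s ^ 2) 0 := by
      have h3 : (fun t : ℝ => a * (2 * x j + 2 * t) + b * s + c * (2 * (x i + s * t) * s)) =
          fun t => (a * (2 * x j) + b * s + c * (2 * x i * s)) + (2 * a + 2 * c * s ^ 2) * t := by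
        funext t
        ring
      rw [h3]
      simpa using ((hasDerivAt_id (0 : ℝ)).const_mul (2 * a + 2 * c * s ^ 2)).const_add
        (a * (2 * x j) + b * s + c * (2 * x i * s))
    rw [h2.deriv, hs]
    split_ifs <;> ring
  unfold lap
  rw [Finset.sum_congr rfl fun j _ => key j]
  simp [Finset.sum_add_distrib]
  ring

/-- Half of the interior gradient estimate for the Poisson equation on a cube. -/
theorem deriv_le_of_lap_bound {u : E → ℝ} (hu : ContDiff ℝ 2 u) {M F : ℝ}
    (hM : ∀ x : E, (∀ j, |x j| ≤ 1) → |u x| ≤ M)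
    (hF : ∀ x : E, (∀ j, |x j| ≤ 1) → |lap u x| < F) (i : Fin N) :
    deriv (fun t : ℝ => u (t • EuclideanSpace.single i (1 : ℝ))) 0 ≤ N * M + F / 2 := by
  have hM0 : 0 ≤ M := (abs_nonneg _).trans (hM 0 (by simp))
  have hF0 : 0 < F := (abs_nonneg _).trans_lt (hF 0 (by simp))
  have hN1 : (1 : ℝ) ≤ N := by
    have : 0 < N := i.pos
    exact_mod_cast this
  set g : E → ℝ := fun x => 2⁻¹ * (u x - u (reflectCoord i x)) with hg
  set ψ : E → ℝ := fun y => M * ‖y‖ ^ 2 + (N * M + F / 2) * y i + (-(N * M + F / 2)) * y i ^ 2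
    with hψ
  have hur : ContDiff ℝ 2 fun x : E => u (reflectCoord i x) := hu.comp (contDiff_reflectCoord i)
  have hgC : ContDiff ℝ 2 g := contDiff_const.mul (hu.sub hur)
  have hψC : ContDiff ℝ 2 ψ := by
    have : ContDiff ℝ 2 fun y : E => ‖y‖ ^ 2 := contDiff_norm_sq ℝ
    simp only [hψ]
    fun_prop
  have hrefl : ∀ x : E, (∀ j, |x j| ≤ 1) → ∀ j, |reflectCoord i x j| ≤ 1 := by
    intro x hx j
    rw [reflectCoord_apply]
    split_ifs
    · simpa using hx i
    · exact hx j
  have hcoord : ∀ j, Continuous fun x : E => x j := fun j => by fun_prop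
  set Q : Set E := {x | (∀ j, |x j| ≤ 1) ∧ 0 ≤ x i} with hQ
  set O : Set E := {x | (∀ j, |x j| < 1) ∧ 0 < x i} with hO
  have hOo : IsOpen O := by
    have : O = (⋂ j, {x : E | |x j| < 1}) ∩ {x : E | 0 < x i} := by
      ext x
      simp [hO]
    rw [this]
    exact (isOpen_iInter_of_finite fun j => isOpen_lt (hcoord j).abs continuous_const).inter
      (isOpen_lt continuous_const (hcoord i))
  have hQcl : IsClosed Q := by
    have : Q = (⋂ j, {x : E | |x j| ≤ 1}) ∩ {x : E | 0 ≤ x i} := by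
      ext x
      simp [hQ]
    rw [this]
    exact (isClosed_iInter fun j => isClosed_le (hcoord j).abs continuous_const).inter
      (isClosed_le continuous_const (hcoord i))
  have hQc : IsCompact Q := by
    refine (isCompact_closedBall (0 : E) (√N)).of_isClosed_subset hQcl fun x hx => ?_
    rw [mem_closedBall_zero_iff, EuclideanSpace.norm_eq]
    apply Real.sqrt_le_sqrt
    calc ∑ j, ‖x j‖ ^ 2 ≤ ∑ _j : Fin N, (1 : ℝ) := by
          refine Finset.sum_le_sum fun j _ => ?_
          have := hx.1 j
          rw [Real.norm_eq_abs]
          exact pow_le_one₀ (abs_nonneg _) this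
      _ = N := by simp
  have hOQ : O ⊆ Q := fun x hx => ⟨fun j => (hx.1 j).le, hx.2.le⟩
  have hgM : ∀ x ∈ Q, g x ≤ M := by
    intro x hx
    have h1 := abs_le.1 (hM x hx.1)
    have h2 := abs_le.1 (hM _ (hrefl x hx.1))
    simp only [hg]
    linarith
  have hbd : ∀ x ∈ Q, x ∉ O → g x ≤ ψ x := by
    intro x hx hxO
    have hxi : x i ≤ 1 := (le_abs_self _).trans (hx.1 i)
    have hψ' : ψ x = M * ‖x‖ ^ 2 + (N * M + F / 2) * (x i * (1 - x i)) := by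
      simp only [hψ]
      ring
    have hpos : 0 ≤ (N * M + F / 2) * (x i * (1 - x i)) := by
      have := hx.2
      have : 0 ≤ 1 - x i := by linarith
      positivity
    by_cases h0 : x i = 0
    · have : reflectCoord i x = x := by simp [reflectCoord, h0]
      have hg0 : g x = 0 := by simp [hg, this]
      rw [hg0, hψ']
      positivity
    · have hj : ∃ j, 1 ≤ |x j| := by
        by_contra! hlt
        exact hxO ⟨hlt, lt_of_le_of_ne hx.2 (Ne.symm h0)⟩
      obtain ⟨j, hj⟩ := hj
      have hnorm : 1 ≤ ‖x‖ := hj.trans (by simpa using PiLp.norm_apply_le x j)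
      have hsq : 1 ≤ ‖x‖ ^ 2 := one_le_pow₀ hnorm
      have := hgM x hx
      nlinarith
  have hlap : ∀ x ∈ O, ψ x < g x → lap ψ x < lap g x := by
    intro x hx _
    have hxQ := (hOQ hx).1
    have h1 : lap ψ x = -F := by
      rw [lap_quadratic]
      ring
    have h2 : lap g x = 2⁻¹ * (lap u x - lap u (reflectCoord i x)) := by
      simp only [hg]
      rw [lap_const_mul, lap_sub hu hur, lap_comp_reflectCoord]
    have h3 := abs_lt.1 (hF x hxQ)
    have h4 := abs_lt.1 (hF _ (hrefl x hxQ))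
    rw [h1, h2]
    linarith
  set G : ℝ → ℝ := fun t => u (t • EuclideanSpace.single i (1 : ℝ)) with hGdef
  have hGd : HasDerivAt G (deriv G 0) 0 := by
    have : ContDiff ℝ 2 G := by simpa using contDiff_line hu 0 (EuclideanSpace.single i (1 : ℝ))
    exact (this.differentiable (by norm_num) 0).hasDerivAt
  have hHd : HasDerivAt (fun t => 2⁻¹ * (G t - G (-t))) (deriv G 0) 0 := by
    have hneg : HasDerivAt (fun t => G (-t)) (-deriv G 0) 0 := by
      have h0 : HasDerivAt G (deriv G 0) (-(0 : ℝ)) := by simpa using hGd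
      simpa [Function.comp_def] using h0.comp (0 : ℝ) (hasDerivAt_neg (0 : ℝ))
    exact ((hGd.sub hneg).const_mul (2⁻¹ : ℝ)).congr_deriv (by ring)
  have hslope := hHd.tendsto_slope_zero_right
  refine le_of_tendsto hslope ?_
  filter_upwards [Ioo_mem_nhdsGT (show (0 : ℝ) < 1 by norm_num)] with t ht
  set y : E := t • EuclideanSpace.single i (1 : ℝ) with hy
  have hyi : y i = t := by simp [hy]
  have hyQ : y ∈ Q := by
    refine ⟨fun j => ?_, by rw [hyi]; exact ht.1.le⟩
    by_cases h : j = i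
    · subst h
      rw [hyi, abs_of_pos ht.1]
      exact ht.2.le
    · simp [hy, h]
  have hle := le_of_lap_lt hψC hgC hQc hOo hOQ hbd hlap hyQ
  have hgy : g y = 2⁻¹ * (G t - G (-t)) := by
    have : reflectCoord i y = (-t) • EuclideanSpace.single i (1 : ℝ) := by
      rw [reflectCoord, hyi, hy, ← sub_smul]
      congr 1
      ring
    simp only [hg, this]
    rfl
  have hψy : ψ y ≤ (N * M + F / 2) * t := by
    have hn : ‖y‖ = t := by simp [hy, norm_smul, abs_of_pos ht.1]
    simp only [hψ, hn, hyi]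
    have h1 : M * t ^ 2 ≤ N * M * t ^ 2 := by
      have : 0 ≤ (N - 1 : ℝ) := by linarith
      have : 0 ≤ (N - 1 : ℝ) * (M * t ^ 2) := by positivity
      linarith
    have h2 : 0 ≤ F / 2 * t ^ 2 := by positivity
    linarith
  have hsimp : t⁻¹ • (2⁻¹ * (G (0 + t) - G (-(0 + t))) - 2⁻¹ * (G 0 - G (-0)))
      = t⁻¹ * g y := by
    rw [hgy]
    simp
  rw [hsimp, inv_mul_le_iff₀ ht.1]
  linarith

/-- Interior gradient estimate for the Poisson equation. -/
theorem norm_fderiv_le_of_lap_bound {u : E → ℝ} (hu : ContDiff ℝ 2 u) {M F : ℝ} (x : E)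
    (hM : ∀ y : E, (∀ j, |y j| ≤ 1) → |u (x + y)| ≤ M)
    (hF : ∀ y : E, (∀ j, |y j| ≤ 1) → |lap u (x + y)| < F) :
    ‖fderiv ℝ u x‖ ≤ N * (N * M + F / 2) := by
  have hM0 : 0 ≤ M := (abs_nonneg _).trans (hM 0 (by simp))
  have hF0 : 0 < F := (abs_nonneg _).trans_lt (hF 0 (by simp))
  have hpart : ∀ i : Fin N, |fderiv ℝ u x (EuclideanSpace.single i 1)| ≤ N * M + F / 2 := by
    intro i
    have hd : deriv (fun t : ℝ => u (x + t • EuclideanSpace.single i (1 : ℝ))) 0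
        = fderiv ℝ u x (EuclideanSpace.single i 1) :=
      ((hu.differentiable (by norm_num) x).hasFDerivAt.hasLineDerivAt _).deriv
    have hux : ContDiff ℝ 2 fun y => u (x + y) := hu.comp (by fun_prop)
    rw [← hd, abs_le']
    refine ⟨deriv_le_of_lap_bound hux hM (fun y hy => ?_) i, ?_⟩
    · rw [lap_comp_add]
      exact hF y hy
    · rw [← deriv.fun_neg]
      refine deriv_le_of_lap_bound (u := fun y => -u (x + y)) hux.neg
        (fun y hy => ?_) (fun y hy => ?_) i
      · rw [abs_neg]
        exact hM y hy
      · rw [lap_neg, lap_comp_add, abs_neg]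
        exact hF y hy
  refine ContinuousLinearMap.opNorm_le_bound _ (by positivity) fun v => ?_
  have hv : v = ∑ i, v i • (EuclideanSpace.single i (1 : ℝ) : E) := by
    ext j
    simp [Finset.sum_apply, Pi.single_apply]
  conv_lhs => rw [hv]
  rw [map_sum]
  calc ‖∑ i, fderiv ℝ u x (v i • EuclideanSpace.single i (1 : ℝ))‖
      ≤ ∑ i : Fin N, (N * M + F / 2) * ‖v‖ := by
        refine norm_sum_le_of_le _ fun i _ => ?_
        rw [map_smul, norm_smul, mul_comm]
        exact mul_le_mul (hpart i) (PiLp.norm_apply_le v i) (norm_nonneg _) (by positivity)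
    _ = N * (N * M + F / 2) * ‖v‖ := by simp; ring

/-- A smooth radial function of exponential growth with rate `η`. -/
noncomputable def expBarrier (η L : ℝ) (y : E) : ℝ := exp (η * √(L ^ 2 + ‖y‖ ^ 2))

theorem contDiff_expBarrier (η : ℝ) {L : ℝ} (hL : 0 < L) :
    ContDiff ℝ 2 (expBarrier η L : E → ℝ) := by
  have h : ContDiff ℝ 2 fun y : E => L ^ 2 + ‖y‖ ^ 2 :=
    contDiff_const.add (contDiff_norm_sq ℝ)
  exact (contDiff_const.mul (h.sqrt fun y => by positivity)).exp

theorem lap_expBarrier_le {η L : ℝ} (hη : 0 < η) (hL : 0 < L) (y : E) :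
    lap (expBarrier η L) y ≤ (η ^ 2 + N * η / L) * expBarrier η L y := by
  set s : ℝ := √(L ^ 2 + ‖y‖ ^ 2) with hs
  have hspos : 0 < s := Real.sqrt_pos.2 (by positivity)
  have hssq : s ^ 2 = L ^ 2 + ‖y‖ ^ 2 := Real.sq_sqrt (by positivity)
  have hLs : L ≤ s := by
    rw [hs]
    exact Real.le_sqrt_of_sq_le (by nlinarith [sq_nonneg ‖y‖])
  have key : ∀ j : Fin N, deriv (deriv fun t : ℝ =>
      expBarrier η L (y + t • EuclideanSpace.single j (1 : ℝ))) 0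
        ≤ (η ^ 2 * (y j ^ 2 / s ^ 2) + η / L) * expBarrier η L y := by
    intro j
    set q : ℝ → ℝ := fun t => L ^ 2 + ‖y + t • EuclideanSpace.single j (1 : ℝ)‖ ^ 2 with hq
    have hqpos : ∀ t, 0 < q t := fun t => by simp only [hq]; positivity
    have hqeq : q = fun t => L ^ 2 + (‖y‖ ^ 2 + 2 * y j * t + t ^ 2) := by
      funext t
      simp only [hq]
      rw [norm_add_sq_real, inner_smul_right, norm_smul]
      simp [EuclideanSpace.inner_single_right]
      ring
    have hqd : ∀ t, HasDerivAt q (2 * (y j + t)) t := by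
      intro t
      rw [hqeq]
      have := ((((hasDerivAt_id t).const_mul (2 * y j)).const_add (‖y‖ ^ 2)).add
          (hasDerivAt_pow 2 t)).const_add (L ^ 2)
      exact this.congr_deriv (by simp; ring)
    have hsd : ∀ t, HasDerivAt (fun t => √(q t)) ((y j + t) / √(q t)) t := by
      intro t
      convert (hqd t).sqrt (hqpos t).ne' using 1
      field_simp
    have hed : ∀ t, HasDerivAt (fun t => exp (η * √(q t)))
        (exp (η * √(q t)) * (η * ((y j + t) / √(q t)))) t :=
      fun t => ((hsd t).const_mul η).exp
    have h1 : (deriv fun t : ℝ => expBarrier η L (y + t • EuclideanSpace.single j (1 : ℝ)))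
        = fun t => exp (η * √(q t)) * (η * ((y j + t) / √(q t))) := by
      funext t
      exact (hed t).deriv
    have hq0 : √(q 0) = s := by simp [hq, hs]
    have hld : HasDerivAt (fun t : ℝ => y j + t) 1 0 := by
      simpa using (hasDerivAt_id (0 : ℝ)).const_add (y j)
    have h2 := ((hed 0).mul (((hld.div (hsd 0) (by rw [hq0]; exact hspos.ne')).const_mul η)))
    rw [h1]
    refine (h2.deriv).le.trans ?_
    simp only [Pi.div_apply, hq0, add_zero]
    have hE : expBarrier η L y = exp (η * s) := rfl
    rw [hE]
    have hexp := exp_pos (η * s)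
    have h3 : exp (η * s) * (η * (y j / s)) * (η * (y j / s)) +
        exp (η * s) * (η * ((1 * s - y j * (y j / s)) / s ^ 2))
        = (η ^ 2 * (y j ^ 2 / s ^ 2) + η / s - η * y j ^ 2 / s ^ 3) * exp (η * s) := by
      field_simp
      ring
    rw [h3]
    apply mul_le_mul_of_nonneg_right _ hexp.le
    have h4 : 0 ≤ η * y j ^ 2 / s ^ 3 := by positivity
    have h5 : η / s ≤ η / L := by gcongr
    linarith
  calc lap (expBarrier η L) y
      ≤ ∑ j : Fin N, (η ^ 2 * (y j ^ 2 / s ^ 2) + η / L) * expBarrier η L y :=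
        Finset.sum_le_sum fun j _ => key j
    _ = (η ^ 2 * (‖y‖ ^ 2 / s ^ 2) + N * η / L) * expBarrier η L y := by
        rw [← Finset.sum_mul, Finset.sum_add_distrib, ← Finset.mul_sum, ← Finset.sum_div,
          EuclideanSpace.real_norm_sq_eq]
        simp
        left
        ring
    _ ≤ (η ^ 2 + N * η / L) * expBarrier η L y := by
        apply mul_le_mul_of_nonneg_right _ (exp_pos _).le
        have : ‖y‖ ^ 2 / s ^ 2 ≤ 1 := by
          rw [div_le_one (by positivity), hssq]
          nlinarith
        nlinarith [sq_nonneg η]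

/-- Decay at the center of a ball on which the potential is at most `1 - κ`. -/
theorem le_exp_of_lap_eq {φ V : E → ℝ} (hφ : ContDiff ℝ 2 φ) (hb : ∀ x, |φ x| ≤ 1)
    (heq : ∀ x, lap φ x = (1 - V x) * φ x) {η L κ r : ℝ} (hη : 0 < η) (hL : 0 < L)
    (hκ : η ^ 2 + N * η / L ≤ κ) (hr : 0 ≤ r) (x : E)
    (hV : ∀ y, dist y x ≤ r → V y ≤ 1 - κ) : φ x ≤ exp (η * L) * exp (-η * r) := by
  set f : E → ℝ := fun y => exp (-η * r) * expBarrier η L (-x + y) with hf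
  have hbar : ContDiff ℝ 2 fun y : E => expBarrier η L (-x + y) :=
    (contDiff_expBarrier η hL).comp (by fun_prop)
  have hfC : ContDiff ℝ 2 f := contDiff_const.mul hbar
  have hκ0 : 0 < κ := lt_of_lt_of_le (by positivity) hκ
  have hmain : φ x ≤ f x := by
    refine le_of_lap_lt hfC hφ (isCompact_closedBall x r) Metric.isOpen_ball
      Metric.ball_subset_closedBall ?_ ?_ (Metric.mem_closedBall_self hr)
    · intro y _ hy
      have hry : r ≤ ‖-x + y‖ := by
        rw [neg_add_eq_sub, ← dist_eq_norm]
        simpa using hy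
      refine (le_abs_self _).trans ((hb y).trans ?_)
      simp only [hf, expBarrier]
      rw [← exp_add]
      apply one_le_exp
      have : r ≤ √(L ^ 2 + ‖-x + y‖ ^ 2) := by
        apply Real.le_sqrt_of_sq_le
        nlinarith
      nlinarith
    · intro y hy hlt
      have hV' := hV y (Metric.mem_ball.1 hy).le
      have hpos : 0 < f y := mul_pos (exp_pos _) (exp_pos _)
      have h1 : lap f y ≤ κ * f y := by
        simp only [hf]
        rw [lap_const_mul, lap_comp_add (expBarrier η L)]
        have h2 := lap_expBarrier_le hη hL (-x + y)
        have h3 : (η ^ 2 + N * η / L) * expBarrier η L (-x + y)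
            ≤ κ * expBarrier η L (-x + y) := mul_le_mul_of_nonneg_right hκ (exp_pos _).le
        have h4 := mul_le_mul_of_nonneg_left (h2.trans h3) (exp_pos (-η * r)).le
        linarith
      rw [heq]
      nlinarith
  refine hmain.trans (le_of_eq ?_)
  simp only [hf, expBarrier]
  simp [Real.sqrt_sq hL.le]
  ring

/-- Exponential decay away from a set outside whose neighborhood the potential is small. -/
theorem abs_le_exp_infDist {φ V : E → ℝ} (hφ : ContDiff ℝ 2 φ) (hb : ∀ x, |φ x| ≤ 1)
    (heq : ∀ x, lap φ x = (1 - V x) * φ x) {η L κ R : ℝ} (hη : 0 < η) (hL : 0 < L)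
    (hκ : η ^ 2 + N * η / L ≤ κ) (S : Set E)
    (hV : ∀ y, R ≤ Metric.infDist y S → V y ≤ 1 - κ) (x : E) :
    |φ x| ≤ exp (η * (L + R)) * exp (-η * Metric.infDist x S) := by
  set d := Metric.infDist x S with hd
  rcases le_or_gt R d with h | h
  · have hV' : ∀ y, dist y x ≤ d - R → V y ≤ 1 - κ := by
      intro y hy
      apply hV
      have := Metric.infDist_le_infDist_add_dist (s := S) (x := x) (y := y)
      rw [dist_comm] at this
      linarith
    have hexp : exp (η * L) * exp (-η * (d - R)) = exp (η * (L + R)) * exp (-η * d) := by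
      rw [← exp_add, ← exp_add]
      congr 1
      ring
    rw [← hexp, abs_le']
    refine ⟨le_exp_of_lap_eq hφ hb heq hη hL hκ (by linarith) x hV', ?_⟩
    refine le_exp_of_lap_eq (φ := fun y => -φ y) hφ.neg (fun y => by simpa using hb y)
      (fun y => ?_) hη hL hκ (by linarith) x hV'
    rw [lap_neg, heq]
    ring
  · refine (hb x).trans ?_
    rw [← exp_add]
    apply one_le_exp
    nlinarith [mul_pos hη hL]

/-- Exponential decay of a solution of `Δφ = (1 - V)φ` together with its gradient. -/
theorem abs_add_norm_fderiv_le_exp_infDist {φ V : E → ℝ} (hφ : ContDiff ℝ 2 φ)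
    (hb : ∀ x, |φ x| ≤ 1) (heq : ∀ x, lap φ x = (1 - V x) * φ x) {η L κ R K : ℝ}
    (hη : 0 < η) (hL : 0 < L) (hκ : η ^ 2 + N * η / L ≤ κ) (S : Set E)
    (hV : ∀ y, R ≤ Metric.infDist y S → V y ≤ 1 - κ) (hV0 : ∀ y, 0 ≤ V y) (hVK : ∀ y, V y ≤ K)
    (x : E) :
    |φ x| + ‖fderiv ℝ φ x‖ ≤ exp (η * (L + R)) * (1 + N * (N * exp (η * N)
      + (2 + K) * exp (η * N) / 2)) * exp (-η * Metric.infDist x S) := by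
  set d := Metric.infDist x S with hd
  set B := exp (η * (L + R)) with hB
  have hdec := abs_le_exp_infDist hφ hb heq hη hL hκ S hV
  have hK : 0 ≤ K := (hV0 x).trans (hVK x)
  have hM : ∀ y : E, (∀ j, |y j| ≤ 1) → |φ (x + y)| ≤ B * (exp (η * N) * exp (-η * d)) := by
    intro y hy
    refine (hdec (x + y)).trans ?_
    rw [← exp_add (η * N)]
    refine mul_le_mul_of_nonneg_left (exp_le_exp.2 ?_) (exp_pos _).le
    have h1 : ‖y‖ ≤ N := by
      have h2 : ‖y‖ ^ 2 ≤ N := by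
        rw [EuclideanSpace.real_norm_sq_eq]
        calc ∑ j, y j ^ 2 ≤ ∑ _j : Fin N, (1 : ℝ) :=
              Finset.sum_le_sum fun j _ => (sq_le_one_iff_abs_le_one _).2 (hy j)
          _ = N := by simp
      have h3 : (N : ℝ) ≤ (N : ℝ) ^ 2 := by exact_mod_cast Nat.le_self_pow (by norm_num) N
      exact le_of_sq_le_sq (h2.trans h3) (by positivity)
    have h2 := Metric.infDist_le_infDist_add_dist (s := S) (x := x) (y := x + y)
    have h3 : dist x (x + y) = ‖y‖ := by simp [dist_eq_norm]
    have h4 : d - N ≤ Metric.infDist (x + y) S := by linarith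
    nlinarith
  have hF : ∀ y : E, (∀ j, |y j| ≤ 1) →
      |lap φ (x + y)| < (2 + K) * (B * (exp (η * N) * exp (-η * d))) := by
    intro y hy
    rw [heq, abs_mul]
    have h1 : |1 - V (x + y)| ≤ 1 + K := by
      rw [abs_le]
      constructor <;> linarith [hV0 (x + y), hVK (x + y)]
    have hpos : 0 < B * (exp (η * N) * exp (-η * d)) := by positivity
    have h2 := mul_le_mul h1 (hM y hy) (abs_nonneg _) (by linarith)
    linarith
  have hgrad := norm_fderiv_le_of_lap_bound hφ x hM hF
  have hx := hdec x
  calc |φ x| + ‖fderiv ℝ φ x‖ ≤ B * exp (-η * d) + _ := add_le_add hx hgrad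
    _ = _ := by ring

end Laplacian

theorem summable_exp_neg_abs_int : Summable fun n : ℤ => exp (-|(n : ℝ)| / 2) := by
  have h : Summable fun n : ℕ => exp (-(n : ℝ) / 2) := by
    have := Real.summable_exp_nat_mul_iff.2 (show (-(1 / 2) : ℝ) < 0 by norm_num)
    refine this.congr fun n => ?_
    congr 1
    ring
  refine Summable.of_nat_of_neg ?_ ?_
  · simpa using h
  · simpa using h

/-- Sums of exponentials centered at separated points of the line are uniformly bounded. -/
theorem summable_exp_of_separated {ι : Type*} {a : ι → ℝ}
    (ha : ∀ i j, i ≠ j → 1 ≤ |a i - a j|) (t : ℝ) :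
    Summable (fun i => exp (-|t - a i| / 2)) ∧
      ∑' i, exp (-|t - a i| / 2) ≤ exp (1 / 2) * ∑' n : ℤ, exp (-|(n : ℝ)| / 2) := by
  have hinj : Function.Injective fun i => ⌊a i - t⌋ := by
    intro i j hij
    by_contra hne
    have h1 := Int.abs_sub_lt_one_of_floor_eq_floor hij
    have h2 := ha i j hne
    rw [sub_sub_sub_cancel_right] at h1
    linarith
  have hs := summable_exp_neg_abs_int.comp_injective hinj
  have hs' := hs.mul_left (exp (1 / 2))
  have hle : ∀ i, exp (-|t - a i| / 2)
      ≤ exp (1 / 2) * exp (-|((⌊a i - t⌋ : ℤ) : ℝ)| / 2) := by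
    intro i
    rw [← exp_add, exp_le_exp]
    have h1 := Int.floor_le (a i - t)
    have h2 := Int.lt_floor_add_one (a i - t)
    have h3 : |((⌊a i - t⌋ : ℤ) : ℝ)| ≤ |t - a i| + 1 := by
      rw [abs_le]
      constructor
      · linarith [le_abs_self (t - a i)]
      · linarith [neg_abs_le (t - a i)]
    linarith
  have hsum : Summable fun i => exp (-|t - a i| / 2) :=
    Summable.of_nonneg_of_le (fun i => (exp_pos _).le) hle hs'
  refine ⟨hsum, (hsum.tsum_le_tsum hle hs').trans ?_⟩
  rw [tsum_mul_left]
  refine mul_le_mul_of_nonneg_left ?_ (exp_pos _).le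
  exact tsum_comp_le_tsum_of_inj summable_exp_neg_abs_int (fun n => (exp_pos _).le) hinj

/-- A continuous function with the decay of a ground state is bounded by `M e^{-‖x‖}`. -/
theorem exists_le_mul_exp_neg_norm {N : ℕ} (hN : 1 ≤ N) {U : EuclideanSpace ℝ (Fin N) → ℝ}
    (hU : Continuous U) {C₀ A : ℝ} (hC₀ : 0 < C₀) (hA : 1 ≤ A)
    (hUb : ∀ x : EuclideanSpace ℝ (Fin N), A ≤ ‖x‖ →
      U x ≤ C₀ * Real.exp (-‖x‖) * ‖x‖ ^ (((1 : ℝ) - N) / 2)) :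
    ∃ M > 0, ∀ x, U x ≤ M * exp (-‖x‖) := by
  obtain ⟨B, hB⟩ := (isCompact_closedBall (0 : EuclideanSpace ℝ (Fin N)) A).bddAbove_image
    hU.continuousOn
  refine ⟨max C₀ (|B| * exp A), lt_max_of_lt_left hC₀, fun x => ?_⟩
  rcases le_total A ‖x‖ with h | h
  · refine (hUb x h).trans ?_
    have hN' : (1 : ℝ) ≤ N := by exact_mod_cast hN
    have h1 : ‖x‖ ^ (((1 : ℝ) - N) / 2) ≤ 1 :=
      Real.rpow_le_one_of_one_le_of_nonpos (hA.trans h) (by linarith)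
    calc C₀ * exp (-‖x‖) * ‖x‖ ^ (((1 : ℝ) - N) / 2) ≤ C₀ * exp (-‖x‖) :=
          mul_le_of_le_one_right (by positivity) h1
      _ ≤ _ := mul_le_mul_of_nonneg_right (le_max_left _ _) (exp_pos _).le
  · have h1 : U x ≤ B := hB ⟨x, by simpa using h, rfl⟩
    calc U x ≤ |B| := h1.trans (le_abs_self B)
      _ ≤ |B| * exp A * exp (-‖x‖) := by
          rw [mul_assoc, ← exp_add]
          exact le_mul_of_one_le_right (abs_nonneg _) (one_le_exp (by linarith))
      _ ≤ _ := mul_le_mul_of_nonneg_right (le_max_right _ _) (exp_pos _).le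

theorem abs_coord_sub_le_norm {N : ℕ} (hN : 0 < N) (x : EuclideanSpace ℝ (Fin N)) (a : ℝ) :
    |x ⟨0, hN⟩ - a| ≤ ‖x - a • e1 N‖ := by
  have := PiLp.norm_apply_le (x - a • e1 N) ⟨0, hN⟩
  simpa [e1, hN] using this

/-- A sum of exponentially decaying bumps centered at separated points of the first axis decays
exponentially away from the centers. -/
theorem tsum_bumps_le {N : ℕ} (hN : 0 < N) {U : EuclideanSpace ℝ (Fin N) → ℝ}
    (hU0 : ∀ x, 0 ≤ U x) {M : ℝ} (hM : 0 ≤ M) (hU : ∀ x, U x ≤ M * exp (-‖x‖)) {ι : Type*}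
    {a : ι → ℝ} (ha : ∀ i j, i ≠ j → 1 ≤ |a i - a j|) {S : Set (EuclideanSpace ℝ (Fin N))}
    (hS : ∀ i, a i • e1 N ∈ S) (x : EuclideanSpace ℝ (Fin N)) :
    ∑' i, U (x - a i • e1 N) ≤ M * (exp (1 / 2) * ∑' n : ℤ, exp (-|(n : ℝ)| / 2))
      * exp (-Metric.infDist x S / 2) := by
  obtain ⟨hs, hle⟩ := summable_exp_of_separated ha (x ⟨0, hN⟩)
  set d := Metric.infDist x S
  have hs' := hs.mul_left (M * exp (-d / 2))
  have hterm : ∀ i, U (x - a i • e1 N)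
      ≤ M * exp (-d / 2) * exp (-|x ⟨0, hN⟩ - a i| / 2) := by
    intro i
    refine (hU _).trans ?_
    rw [mul_assoc, ← exp_add]
    refine mul_le_mul_of_nonneg_left (exp_le_exp.2 ?_) hM
    have h1 := abs_coord_sub_le_norm hN x (a i)
    have h2 : d ≤ ‖x - a i • e1 N‖ := by
      rw [← dist_eq_norm]
      exact Metric.infDist_le_dist_of_mem (hS i)
    linarith
  have hsU := Summable.of_nonneg_of_le (fun i => hU0 _) hterm hs'
  refine (hsU.tsum_le_tsum hterm hs').trans ?_
  rw [tsum_mul_left]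
  calc _ ≤ M * exp (-d / 2) * (exp (1 / 2) * ∑' n : ℤ, exp (-|(n : ℝ)| / 2)) :=
        mul_le_mul_of_nonneg_left hle (by positivity)
    _ = _ := by ring

/-- Uniform exponential decay of eigenfunctions of `𝕃 = -Δ + 1 - pū_ε^{p-1}` whose
eigenvalue stays away from `1`: `|φ(x)| + |∇φ(x)| ≤ C e^{-η d_x}`, `d_x` the distance
to the set of bump centers, with `C` independent of `ε` (i.e. of the configuration). -/
theorem stmt16 (N : ℕ) (hN : 2 ≤ N) (p : ℝ) (hp : 2 ≤ p)
    (U : EuclideanSpace ℝ (Fin N) → ℝ)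
    (hUpos : ∀ x, 0 < U x) (hUsmooth : ContDiff ℝ (⊤ : ℕ∞) U)
    (hUeq : ∀ x, -(lap U x) + U x = U x ^ p)
    (C₀ A : ℝ) (hC₀ : 0 < C₀) (hA : 1 ≤ A)
    (hUb : ∀ x : EuclideanSpace ℝ (Fin N), A ≤ ‖x‖ →
      U x ≤ C₀ * Real.exp (-‖x‖) * ‖x‖ ^ (((1 : ℝ) - N) / 2))
    (η δ : ℝ) (hη : 0 < η) (hη1 : η < 1) (hδ : 0 < δ) :
    ∃ C > 0, ∃ σ₀ : ℝ, ∀ (P : ℝ), 0 < P → ∀ (k : ℕ), 1 ≤ k →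
      ∀ (c : Fin k → ℝ) (σ : ℝ), σ₀ ≤ σ →
      (∀ i j : Fin k, ∀ l : ℤ, (i ≠ j ∨ l ≠ 0) → 2 * σ ≤ |c i - c j + P * l|) →
      ∀ ubar : EuclideanSpace ℝ (Fin N) → ℝ,
        (∀ x, ubar x = ∑' q : Fin k × ℤ, U (x - (c q.1 + P * (q.2 : ℝ)) • e1 N)) →
      ∀ (φ : EuclideanSpace ℝ (Fin N) → ℝ) (lam : ℝ),
        ContDiff ℝ 2 φ →
        (∀ x, φ (x + P • e1 N) = φ x) →
        (∀ x, |φ x| ≤ 1) → (∃ x, |φ x| = 1) →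
        (∀ δ' : ℝ, 0 < δ' → ∃ R : ℝ, ∀ x : EuclideanSpace ℝ (Fin N),
          R ≤ ‖x - x (⟨0, by omega⟩ : Fin N) • e1 N‖ → |φ x| ≤ δ') →
        lam ≤ 1 - δ →
        (∀ x, -(lap φ x) + φ x - p * ubar x ^ (p - 1) * φ x
          = lam * (-(lap φ x) + φ x)) →
        ∀ x : EuclideanSpace ℝ (Fin N),
          |φ x| + ‖fderiv ℝ φ x‖
            ≤ C * Real.exp (-η * Metric.infDist x
                {y : EuclideanSpace ℝ (Fin N) |
                  ∃ (i : Fin k) (l : ℤ), y = (c i + P * (l : ℝ)) • e1 N}) := by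
  obtain ⟨M, hM, hUM⟩ := exists_le_mul_exp_neg_norm (by omega) hUsmooth.continuous hC₀ hA hUb
  set T : ℝ := ∑' n : ℤ, exp (-|(n : ℝ)| / 2) with hT
  have hT0 : 0 ≤ T := tsum_nonneg fun n => (exp_pos _).le
  set K : ℝ := M * (exp (1 / 2) * T) with hK
  have hK0 : 0 ≤ K := by positivity
  have hp0 : 0 < p := by linarith
  set κ : ℝ := (1 + η ^ 2) / 2 with hκ
  have hη2 : η ^ 2 < 1 := by nlinarith
  have hκ1 : κ < 1 := by linarith
  have hNpos : (0 : ℝ) < N := by exact_mod_cast (by omega : 0 < N)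
  set L : ℝ := N * η / (κ - η ^ 2) with hL
  have hκη : 0 < κ - η ^ 2 := by linarith
  have hL0 : 0 < L := by positivity
  have hbarr : η ^ 2 + N * η / L ≤ κ := by
    have : N * η / L = κ - η ^ 2 := by
      rw [hL]
      field_simp
    linarith
  set τ : ℝ := min 1 ((1 - κ) * δ / p) with hτ
  have hκ2 : 0 < 1 - κ := by linarith
  have hτ0 : 0 < τ := lt_min one_pos (by positivity)
  obtain ⟨R, hR⟩ : ∃ R : ℝ, ∀ d, R ≤ d → K * exp (-d / 2) ≤ τ := by
    have hlim : Filter.Tendsto (fun d : ℝ => K * exp (-d / 2)) Filter.atTop (nhds 0) := by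
      have h1 : Filter.Tendsto (fun d : ℝ => d / 2) Filter.atTop Filter.atTop :=
        Filter.tendsto_id.atTop_div_const (by norm_num)
      have h2 := (Real.tendsto_exp_neg_atTop_nhds_zero.comp h1).const_mul K
      simpa [Function.comp_def, neg_div] using h2
    exact Filter.eventually_atTop.1 (hlim.eventually_le_const hτ0)
  refine ⟨exp (η * (L + R)) * (1 + N * (N * exp (η * N)
      + (2 + p / δ * K ^ (p - 1)) * exp (η * N) / 2)), by positivity, 1, ?_⟩
  intro P hP k hk c σ hσ hsep ubar hubar φ lam hφ _ hφ1 _ _ hlam heig x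
  set S : Set (EuclideanSpace ℝ (Fin N)) := {y | ∃ (i : Fin k) (l : ℤ),
    y = (c i + P * (l : ℝ)) • e1 N} with hS
  have hlam' : δ ≤ 1 - lam := by linarith
  have hlam0 : 0 < 1 - lam := by linarith
  have hu0 : ∀ y, 0 ≤ ubar y := fun y => by
    rw [hubar]
    exact tsum_nonneg fun q => (hUpos _).le
  have hsep' : ∀ q q' : Fin k × ℤ, q ≠ q' →
      1 ≤ |(c q.1 + P * (q.2 : ℝ)) - (c q'.1 + P * (q'.2 : ℝ))| := by
    intro q q' hne
    have h := hsep q.1 q'.1 (q.2 - q'.2) (by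
      by_contra! hcon
      exact hne (Prod.ext hcon.1 (by linarith [hcon.2])))
    push_cast at h
    have h2 : (c q.1 + P * (q.2 : ℝ)) - (c q'.1 + P * (q'.2 : ℝ))
        = c q.1 - c q'.1 + P * ((q.2 : ℝ) - q'.2) := by ring
    rw [h2]
    linarith
  have huK : ∀ y, ubar y ≤ K * exp (-Metric.infDist y S / 2) := fun y => by
    rw [hubar]
    exact tsum_bumps_le (S := S) (by omega) (fun z => (hUpos z).le) hM.le hUM hsep'
      (fun q => ⟨q.1, q.2, rfl⟩) y
  set V : EuclideanSpace ℝ (Fin N) → ℝ := fun y => p / (1 - lam) * ubar y ^ (p - 1) with hV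
  have hVle : ∀ y b, ubar y ≤ b → V y ≤ p / δ * b ^ (p - 1) := by
    intro y b hb
    have h1 : p / (1 - lam) ≤ p / δ := by gcongr
    have h2 : ubar y ^ (p - 1) ≤ b ^ (p - 1) :=
      Real.rpow_le_rpow (hu0 y) hb (by linarith)
    exact mul_le_mul h1 h2 (Real.rpow_nonneg (hu0 y) _) (by positivity)
  refine abs_add_norm_fderiv_le_exp_infDist (V := V) hφ hφ1 ?_ hη hL0 hbarr S ?_ ?_ ?_ x
  · intro y
    have h := heig y
    simp only [hV]
    field_simp
    linarith
  · intro y hy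
    refine (hVle y τ ((huK y).trans (hR _ hy))).trans ?_
    have h1 : τ ^ (p - 1) ≤ τ := by
      conv_rhs => rw [← Real.rpow_one τ]
      exact Real.rpow_le_rpow_of_exponent_ge hτ0 (min_le_left _ _) (by linarith)
    calc p / δ * τ ^ (p - 1) ≤ p / δ * ((1 - κ) * δ / p) :=
          mul_le_mul_of_nonneg_left (h1.trans (min_le_right _ _)) (by positivity)
      _ = 1 - κ := by field_simp
  · intro y
    have := Real.rpow_nonneg (hu0 y) (p - 1)
    simp only [hV]
    positivity
  · intro y
    refine hVle y K ((huK y).trans (mul_le_of_le_one_right hK0 (exp_le_one_iff.2 ?_)))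
    have := Metric.infDist_nonneg (x := y) (s := S)
    linarith
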